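/- The left-invariant differential operator y∂z + ∂x + i∂y + ix∂z on ℝ³ (coordinates (z,y,x)) is solvable on smooth functions: for every g ∈ C^∞(ℝ³,ℂ) there exists f ∈ C^∞(ℝ³,ℂ) such that (y∂z + ∂x + i∂y + ix∂z) f = g. -/

import Mathlib

open Complex

/-- Partial derivative in the first coordinate `z` of a function on `ℝ³`
(coordinates written `(z, y, x)`). -/
noncomputable def Pz (f : ℝ × ℝ × ℝ → ℂ) : ℝ × ℝ × ℝ → ℂ :=
  fun p => deriv (fun t => f (t, p.2.1, p.2.2)) p.1

/-- Partial derivative in the second coordinate `y`. -/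
noncomputable def Py (f : ℝ × ℝ × ℝ → ℂ) : ℝ × ℝ × ℝ → ℂ :=
  fun p => deriv (fun t => f (p.1, t, p.2.2)) p.2.1

/-- Partial derivative in the third coordinate `x`. -/
noncomputable def Px (f : ℝ × ℝ × ℝ → ℂ) : ℝ × ℝ × ℝ → ℂ :=
  fun p => deriv (fun t => f (p.1, p.2.1, t)) p.2.2

/-- The left-invariant operator `y∂z + ∂x + i∂y + ix∂z`. -/
noncomputable def OpL (f : ℝ × ℝ × ℝ → ℂ) : ℝ × ℝ × ℝ → ℂ :=
  fun p => (p.2.1 : ℂ) * Pz f p + Px f p + Complex.I * Py f p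
    + Complex.I * (p.2.2 : ℂ) * Pz f p

open MeasureTheory Set Filter Topology

noncomputable def dK (t : ℂ) : ℂ := (2 * (Real.pi : ℂ) * t)⁻¹

lemma dK_locInt : LocallyIntegrable dK volume := by
  have hmeas : AEStronglyMeasurable dK volume := by
    unfold dK; exact (by fun_prop : Measurable fun t : ℂ => (2 * (Real.pi : ℂ) * t)⁻¹).aestronglyMeasurable
  have key : ∀ R : ℝ, 0 < R → IntegrableOn dK (Metric.ball 0 R) volume := by
    intro R hR
    have h1 : Integrable (fun t : ℂ => (Iio R).indicator (fun r : ℝ => (2 * Real.pi * r)⁻¹) ‖t‖) volume := by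
      have := (integrable_fun_norm_addHaar (E := ℂ) (volume : Measure ℂ)
        (f := (Iio R).indicator (fun r : ℝ => (2 * Real.pi * r)⁻¹))).2 (by
          have h2 : IntegrableOn (fun _ : ℝ => (2 * Real.pi)⁻¹) (Ioo 0 R) :=
            integrableOn_const (by simp)
          have h3 : IntegrableOn ((Ioo 0 R).indicator (fun _ : ℝ => (2 * Real.pi)⁻¹)) (Ioi 0) :=
            (h2.integrable_indicator measurableSet_Ioo).integrableOn
          refine h3.congr_fun ?_ measurableSet_Ioi
          intro y hy
          have hy' : (0:ℝ) < y := hy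
          by_cases h : y < R
          · simp [indicator, h, hy']
            field_simp
          · simp [indicator, h])
      exact this
    have h2 : Integrable ((Metric.ball (0:ℂ) R).indicator dK) volume := by
      refine h1.mono' (hmeas.indicator Metric.isOpen_ball.measurableSet) (ae_of_all _ fun t => ?_)
      by_cases h : ‖t‖ < R
      · simp [indicator, h, dK, abs_of_pos Real.pi_pos]
      · simp [indicator, h]
    exact (integrable_indicator_iff Metric.isOpen_ball.measurableSet).1 h2
  intro x
  refine ⟨Metric.ball 0 (‖x‖ + 1), Metric.isOpen_ball.mem_nhds (by simp), key _ (by positivity)⟩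

lemma polar_int_aux {F : ℝ × ℝ → ℂ} (hF : Continuous F) (R : ℝ)
    (h0 : ∀ p : ℝ × ℝ, R < p.1 → F p = 0) :
    IntegrableOn F (Ioi (0:ℝ) ×ˢ Ioo (-Real.pi) Real.pi) := by
  have h1 : IntegrableOn F (Icc (0:ℝ) R ×ˢ Icc (-Real.pi) Real.pi) :=
    hF.continuousOn.integrableOn_compact (isCompact_Icc.prod isCompact_Icc)
  refine h1.of_forall_sdiff_eq_zero (measurableSet_Ioi.prod measurableSet_Ioo) ?_
  rintro ⟨r, θ⟩ ⟨⟨hr, hθ⟩, hn⟩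
  apply h0
  by_contra hc
  simp only [not_lt] at hc
  exact hn ⟨⟨le_of_lt hr, hc⟩, ⟨hθ.1.le, hθ.2.le⟩⟩

lemma cauchy_aux (ψ : ℂ → ℂ) (hψ : ContDiff ℝ 1 ψ) (R : ℝ)
    (hs : ∀ t, R ≤ ‖t‖ → ψ t = 0) :
    ∫ t, dK t * (fderiv ℝ ψ t 1 + I * fderiv ℝ ψ t I) = - ψ 0 := by
  have hd : Continuous (fderiv ℝ ψ) := hψ.continuous_fderiv (by norm_num)
  have hs' : ∀ t, R < ‖t‖ → fderiv ℝ ψ t = 0 := by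
    intro t ht
    have : ψ =ᶠ[𝓝 t] fun _ => 0 := by
      filter_upwards [(isOpen_lt continuous_const continuous_norm).mem_nhds ht] with s hs1
      exact hs s (le_of_lt hs1)
    rw [this.fderiv_eq]; simp
  set e : ℝ → ℂ := fun θ => exp (θ * I) with he
  have hec : Continuous e := by fun_prop
  have hen : ∀ θ, ‖e θ‖ = 1 := fun θ => by simp [he, norm_exp_ofReal_mul_I]
  set A : ℝ × ℝ → ℂ := fun p => fderiv ℝ ψ (p.1 * e p.2) (e p.2) with hA
  set B : ℝ × ℝ → ℂ := fun p => I * fderiv ℝ ψ (p.1 * e p.2) (I * e p.2) with hB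
  have hAc : Continuous A := by
    refine (hd.comp (by fun_prop)).clm_apply (by fun_prop)
  have hBc : Continuous B := by
    refine continuous_const.mul ((hd.comp (by fun_prop)).clm_apply (by fun_prop))
  have hnorm : ∀ p : ℝ × ℝ, R < p.1 → R < ‖(p.1 : ℂ) * e p.2‖ := by
    intro p hp
    rw [norm_mul, hen, mul_one, norm_real]
    exact lt_of_lt_of_le hp (le_abs_self _)
  have hAi := polar_int_aux hAc R (fun p hp => by simp [hA, hs' _ (hnorm p hp)])
  have hBi := polar_int_aux hBc R (fun p hp => by simp [hB, hs' _ (hnorm p hp)])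
  rw [← Complex.integral_comp_polarCoord_symm]
  have hcongr : ∫ p in polarCoord.target, p.1 • (dK (Complex.polarCoord.symm p) *
      (fderiv ℝ ψ (Complex.polarCoord.symm p) 1 + I * fderiv ℝ ψ (Complex.polarCoord.symm p) I))
      = ∫ p in Ioi (0:ℝ) ×ˢ Ioo (-Real.pi) Real.pi, (2 * (Real.pi:ℂ))⁻¹ * (A p + B p) := by
    refine setIntegral_congr_fun (measurableSet_Ioi.prod measurableSet_Ioo) ?_
    rintro ⟨r, θ⟩ ⟨hr, -⟩
    have hr' : (r : ℂ) ≠ 0 := by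
      have : (0:ℝ) < r := hr
      exact_mod_cast this.ne'
    have hsym : Complex.polarCoord.symm (r, θ) = r * e θ := by
      rw [Complex.polarCoord_symm_apply]; simp [he, exp_mul_I]
    have hene : e θ ≠ 0 := exp_ne_zero _
    simp only [hsym, hA, hB]
    set D := fderiv ℝ ψ (r * e θ)
    have hlin : ∀ z : ℂ, D z = z.re * D 1 + z.im * D I := by
      intro z
      conv_lhs => rw [show z = z.re • (1:ℂ) + z.im • I by simp]
      rw [map_add, map_smul, map_smul]; simp
    have h1 : D (e θ) + I * D (I * e θ) = (e θ)⁻¹ * (D 1 + I * D I) := by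
      rw [hlin (e θ), hlin (I * e θ)]
      have hinv : (e θ)⁻¹ = (e θ).re - (e θ).im * I := by
        rw [Complex.inv_def, Complex.normSq_eq_norm_sq, hen]
        apply Complex.ext <;> simp
      rw [hinv]
      simp only [mul_re, mul_im, I_re, I_im, zero_mul, one_mul, zero_sub, zero_add]
      push_cast
      linear_combination (((e θ).im : ℂ) * D I) * I_sq
    rw [h1]
    simp only [dK, real_smul]
    field_simp
  rw [hcongr, integral_const_mul, integral_add hAi hBi]
  have hBz : ∫ p in Ioi (0:ℝ) ×ˢ Ioo (-Real.pi) Real.pi, B p = 0 := by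
    rw [Measure.volume_eq_prod, setIntegral_prod _ (by rw [← Measure.volume_eq_prod]; exact hBi)]
    refine (setIntegral_congr_fun measurableSet_Ioi fun r hr => ?_).trans (integral_zero _ _)
    have hr0 : (0:ℝ) < r := hr
    have hr' : (r : ℂ) ≠ 0 := by exact_mod_cast hr0.ne'
    rw [← integral_Ioc_eq_integral_Ioo, ← intervalIntegral.integral_of_le (by linarith [Real.pi_pos])]
    have hder : ∀ θ : ℝ, HasDerivAt (fun θ : ℝ => I * (r:ℂ)⁻¹ * ψ (r * e θ)) (B (r, θ)) θ := by
      intro θ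
      have h1 : HasDerivAt (fun θ : ℝ => (r : ℂ) * e θ) (r * (I * e θ)) θ := by
        have : HasDerivAt e (exp (θ * I) * (1 * I)) θ :=
          ((Complex.ofRealCLM.hasDerivAt (x := θ)).mul_const I).cexp
        refine (this.const_mul (r : ℂ)).congr_deriv ?_
        simp only [he]; ring
      have h2 := ((hψ.differentiable (by norm_num)) (r * e θ)).hasFDerivAt.comp_hasDerivAt θ h1
      refine (h2.const_mul (I * (r:ℂ)⁻¹)).congr_deriv ?_
      simp only [hB]
      rw [show (r:ℂ) * (I * e θ) = r • (I * e θ) by simp, map_smul, real_smul]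
      field_simp
    rw [intervalIntegral.integral_eq_sub_of_hasDerivAt (fun θ _ => hder θ)
      ((hBc.comp (by fun_prop)).intervalIntegrable _ _)]
    have : e Real.pi = e (-Real.pi) := by
      simp [he, exp_neg, exp_pi_mul_I]
    simp [this]
  have hAz : ∫ p in Ioi (0:ℝ) ×ˢ Ioo (-Real.pi) Real.pi, A p = - (2 * (Real.pi:ℂ)) * ψ 0 := by
    rw [Measure.volume_eq_prod, ← setIntegral_prod_swap, setIntegral_prod _ (by
      rw [← Measure.volume_eq_prod]
      have := hAi
      rw [Measure.volume_eq_prod] at this ⊢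
      exact this.swap)]
    have : ∀ θ : ℝ, ∫ r in Ioi (0:ℝ), A (r, θ) = - ψ 0 := by
      intro θ
      have hder : ∀ r ∈ Ici (0:ℝ), HasDerivAt (fun r : ℝ => ψ (r * e θ)) (A (r, θ)) r := by
        intro r _
        have h1 : HasDerivAt (fun r : ℝ => (r : ℂ) * e θ) (e θ) r := by
          simpa using (Complex.ofRealCLM.hasDerivAt (x := r)).mul_const (e θ)
        exact ((hψ.differentiable (by norm_num)) (r * e θ)).hasFDerivAt.comp_hasDerivAt r h1
      have hint : IntegrableOn (fun r => A (r, θ)) (Ioi (0:ℝ)) := by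
        have h1 : IntegrableOn (fun r => A (r, θ)) (Icc (0:ℝ) R) :=
          (hAc.comp (by fun_prop : Continuous fun r : ℝ => (r, θ))).continuousOn.integrableOn_compact isCompact_Icc
        refine h1.of_forall_sdiff_eq_zero measurableSet_Ioi ?_
        rintro r ⟨hr, hn⟩
        have : R < r := by
          by_contra hc
          exact hn ⟨le_of_lt hr, not_lt.1 hc⟩
        simp [hA, hs' _ (hnorm (r, θ) this)]
      have ht : Tendsto (fun r : ℝ => ψ (r * e θ)) atTop (𝓝 0) := by
        refine tendsto_const_nhds.congr' ?_
        filter_upwards [eventually_gt_atTop R] with r hr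
        exact (hs _ (hnorm (r, θ) hr).le).symm
      have := integral_Ioi_of_hasDerivAt_of_tendsto' hder hint ht
      simpa using this
    simp only [Prod.swap, this]
    simp [two_mul, Measure.real]
    rw [ENNReal.toReal_ofReal (by linarith [Real.pi_pos])]
    push_cast; ring
  rw [hAz, hBz]
  have : (Real.pi : ℂ) ≠ 0 := by exact_mod_cast Real.pi_ne_zero
  field_simp
  simp


lemma cauchy_param (G : ℝ × ℂ → ℂ) (hG : ContDiff ℝ (⊤ : ℕ∞) G) (R : ℝ)
    (hs : ∀ w t, R ≤ ‖t‖ → G (w, t) = 0) :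
    ContDiff ℝ (⊤ : ℕ∞) (fun p : ℝ × ℂ => ∫ t, dK (p.2 - t) * G (p.1, t)) ∧
    ∀ p : ℝ × ℂ, fderiv ℝ (fun p : ℝ × ℂ => ∫ t, dK (p.2 - t) * G (p.1, t)) p (0, 1)
      + I * fderiv ℝ (fun p : ℝ × ℂ => ∫ t, dK (p.2 - t) * G (p.1, t)) p (0, I) = G p := by
  have hconv : (fun p : ℝ × ℂ => ∫ t, dK (p.2 - t) * G (p.1, t)) = fun p : ℝ × ℂ =>
      (convolution dK (fun t => G (p.1, t)) (ContinuousLinearMap.mul ℝ ℂ) volume) p.2 := by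
    funext p
    rw [convolution_eq_swap]; rfl
  have hsm : ContDiff ℝ (⊤ : ℕ∞) (fun p : ℝ × ℂ => ∫ t, dK (p.2 - t) * G (p.1, t)) := by
    rw [hconv]
    have := contDiffOn_convolution_right_with_param (𝕜 := ℝ) (μ := (volume : Measure ℂ)) (f := dK)
      (n := ⊤) (ContinuousLinearMap.mul ℝ ℂ) (g := fun (w : ℝ) t => G (w, t))
      (s := univ) (k := Metric.closedBall 0 R) isOpen_univ (isCompact_closedBall _ _)
      (fun w t _ ht => hs w t (by
        simp at ht; exact ht.le)) dK_locInt (by exact hG.contDiffOn)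
    rwa [univ_prod_univ, contDiffOn_univ] at this
  refine ⟨hsm, ?_⟩
  rintro ⟨w, ζ⟩
  set u := (fun p : ℝ × ℂ => ∫ t, dK (p.2 - t) * G (p.1, t)) with hu
  set φ : ℂ → ℂ := fun t => G (w, t) with hφ
  have hφs : ContDiff ℝ (⊤ : ℕ∞) φ := hG.comp (by fun_prop)
  have hφ1 : ContDiff ℝ 1 φ := hφs.of_le (by exact_mod_cast le_top)
  have hφc : HasCompactSupport φ := by
    refine HasCompactSupport.intro (isCompact_closedBall (0:ℂ) R) fun t ht => hs w t ?_
    simp at ht; exact ht.le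
  have h1 : HasFDerivAt (fun z : ℂ => u (w, z))
      ((convolution dK (fderiv ℝ φ) ((ContinuousLinearMap.mul ℝ ℂ).precompR ℂ) volume) ζ) ζ := by
    rw [hconv]
    exact hφc.hasFDerivAt_convolution_right (ContinuousLinearMap.mul ℝ ℂ) dK_locInt hφ1 ζ
  have h2 : HasFDerivAt (fun z : ℂ => u (w, z))
      ((fderiv ℝ u (w, ζ)).comp (ContinuousLinearMap.inr ℝ ℝ ℂ)) ζ := by
    have := (hsm.differentiable (by simp) (w, ζ)).hasFDerivAt
    exact this.comp ζ (hasFDerivAt_prodMk_right w ζ)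
  have h3 := h2.unique h1
  have hval : ∀ v : ℂ, fderiv ℝ u (w, ζ) (0, v) = ∫ t, dK t * fderiv ℝ φ (ζ - t) v := by
    intro v
    have := congrArg (fun L : ℂ →L[ℝ] ℂ => L v) h3
    simp only [ContinuousLinearMap.comp_apply, ContinuousLinearMap.inr_apply] at this
    rw [this, convolution_precompR_apply _ dK_locInt (hφc.fderiv (𝕜 := ℝ))
      (hφ1.continuous_fderiv (by norm_num))]
    rfl
  have hint : ∀ v : ℂ, Integrable (fun t => dK t * fderiv ℝ φ (ζ - t) v) := by
    intro v
    have hc : HasCompactSupport (fun t => fderiv ℝ φ t v) := hφc.fderiv_apply (𝕜 := ℝ) v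
    exact (hc.convolutionExists_right (ContinuousLinearMap.mul ℝ ℂ) dK_locInt
      ((hφ1.continuous_fderiv (by norm_num)).clm_apply continuous_const) ζ)
  rw [hval, hval, ← integral_const_mul, ← integral_add (hint 1) ((hint I).const_mul I)]
  set ψ : ℂ → ℂ := fun t => φ (ζ - t) with hψ
  have hψ1 : ContDiff ℝ 1 ψ := hφ1.comp (by fun_prop)
  have hder : ∀ t v, fderiv ℝ ψ t v = - fderiv ℝ φ (ζ - t) v := by
    intro t v
    have h := ((hφ1.differentiable (by norm_num)) (ζ - t)).hasFDerivAt.comp t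
      ((hasFDerivAt_id (𝕜 := ℝ) t).const_sub ζ)
    have h' : fderiv ℝ ψ t = _ := h.fderiv
    rw [h']; simp
  have key := cauchy_aux ψ hψ1 (|R| + ‖ζ‖ + 1) (fun t ht => hs w _ (by
    have := norm_sub_norm_le t ζ
    rw [norm_sub_rev] at this
    linarith [le_abs_self R]))
  have hψ0 : ψ 0 = G (w, ζ) := by simp [hψ, hφ]
  rw [hψ0] at key
  rw [← neg_neg (G (w, ζ)), ← key, ← integral_neg]
  congr 1; funext t
  rw [hder, hder]; ring

/-- partial derivative in the parameter -/
noncomputable def Dp {E : Type} [NormedAddCommGroup E] [NormedSpace ℝ E]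
    (F : (ℝ × ℂ) × ℂ → E) : (ℝ × ℂ) × ℂ → ((ℝ × ℂ) →L[ℝ] E) :=
  fun x => (fderiv ℝ F x).comp (ContinuousLinearMap.inl ℝ (ℝ × ℂ) ℂ)

section
variable {E : Type} [NormedAddCommGroup E] [NormedSpace ℝ E]

lemma Dp_contDiff {F : (ℝ × ℂ) × ℂ → E} (hF : ContDiff ℝ (⊤ : ℕ∞) F) :
    ContDiff ℝ (⊤ : ℕ∞) (Dp F) := by
  unfold Dp
  exact (hF.fderiv_right (m := (⊤ : ℕ∞)) (by simp)).clm_comp contDiff_const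

lemma Dp_hasFDerivAt {F : (ℝ × ℂ) × ℂ → E} (hF : ContDiff ℝ (⊤ : ℕ∞) F) (p : ℝ × ℂ) (η : ℂ) :
    HasFDerivAt (fun p => F (p, η)) (Dp F (p, η)) p :=
  ((hF.differentiable (by simp)) (p, η)).hasFDerivAt.comp p (hasFDerivAt_prodMk_left p η)

lemma Dp_zero {F : (ℝ × ℂ) × ℂ → E} (hF : ContDiff ℝ (⊤ : ℕ∞) F) {k : Set ℂ}
    (h0 : ∀ p η, η ∉ k → F (p, η) = 0) : ∀ p η, η ∉ k → Dp F (p, η) = 0 := by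
  intro p η hη
  have h1 := Dp_hasFDerivAt hF p η
  have h2 : (fun p => F (p, η)) = fun _ => 0 := by funext p; exact h0 p η hη
  rw [h2] at h1
  exact h1.unique (hasFDerivAt_const _ _)

lemma slice_integrable {F : (ℝ × ℂ) × ℂ → E} (hF : Continuous F) {k : Set ℂ} (hk : IsCompact k)
    (h0 : ∀ p η, η ∉ k → F (p, η) = 0) (p : ℝ × ℂ) : Integrable (fun η => F (p, η)) := by
  refine (hF.comp (by fun_prop)).integrable_of_hasCompactSupport
    (HasCompactSupport.intro hk fun t ht => h0 p t ht)

lemma int_hasFDerivAt {F : (ℝ × ℂ) × ℂ → E} (hF : ContDiff ℝ (⊤ : ℕ∞) F) {k : Set ℂ}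
    (hk : IsCompact k) (h0 : ∀ p η, η ∉ k → F (p, η) = 0) (p : ℝ × ℂ) :
    HasFDerivAt (fun p => ∫ η, F (p, η)) (∫ η, Dp F (p, η)) p := by
  have hD := (Dp_contDiff hF).continuous
  obtain ⟨C, hC⟩ := ((isCompact_closedBall p 1).prod hk).exists_bound_of_continuousOn
    hD.continuousOn
  refine hasFDerivAt_integral_of_dominated_of_fderiv_le (F' := fun p η => Dp F (p, η))
    (bound := k.indicator fun _ => C) (Metric.closedBall_mem_nhds p one_pos)
    (Eventually.of_forall fun x => (slice_integrable hF.continuous hk h0 x).aestronglyMeasurable)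
    (slice_integrable hF.continuous hk h0 p)
    (slice_integrable hD hk (Dp_zero hF h0) p).aestronglyMeasurable ?_ ?_ ?_
  · refine ae_of_all _ fun η x hx => ?_
    by_cases hη : η ∈ k
    · rw [indicator_of_mem hη]; exact hC (x, η) ⟨hx, hη⟩
    · rw [indicator_of_notMem hη, Dp_zero hF h0 _ _ hη, norm_zero]
  · exact (integrableOn_const (hk.measure_lt_top.ne)).integrable_indicator hk.measurableSet
  · exact ae_of_all _ fun η x _ => Dp_hasFDerivAt hF x η

end

lemma int_contDiff_nat (n : ℕ) : ∀ {E : Type} [NormedAddCommGroup E] [NormedSpace ℝ E]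
    {F : (ℝ × ℂ) × ℂ → E} (_ : ContDiff ℝ (⊤ : ℕ∞) F) {k : Set ℂ}
    (_ : IsCompact k) (_ : ∀ p η, η ∉ k → F (p, η) = 0),
    ContDiff ℝ n (fun p => ∫ η, F (p, η)) := by
  induction n with
  | zero =>
    intro E _ _ F hF k hk h0
    rw [Nat.cast_zero, contDiff_zero, continuous_iff_continuousAt]
    exact fun p => (int_hasFDerivAt hF hk h0 p).continuousAt
  | succ n ih =>
    intro E _ _ F hF k hk h0
    rw [Nat.cast_succ, contDiff_succ_iff_fderiv]
    refine ⟨fun p => (int_hasFDerivAt hF hk h0 p).differentiableAt, by simp, ?_⟩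
    have : fderiv ℝ (fun p => ∫ η, F (p, η)) = fun p => ∫ η, Dp F (p, η) :=
      funext fun p => (int_hasFDerivAt hF hk h0 p).fderiv
    rw [this]
    exact ih (Dp_contDiff hF) hk (Dp_zero hF h0)

section
variable {E : Type} [NormedAddCommGroup E] [NormedSpace ℝ E] [NormedSpace ℂ E]
  [IsScalarTower ℝ ℂ E] [SMulCommClass ℝ ℂ E]

/-- derivative of `q` times `b` -/
noncomputable def Tq (q : (ℝ × ℂ) × ℂ → ℂ) (b : (ℝ × ℂ) × ℂ → E) :
    (ℝ × ℂ) × ℂ → ((ℝ × ℂ) →L[ℝ] E) :=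
  fun x => (Dp q x).smulRight (b x)

lemma Dp_smul {q : (ℝ × ℂ) × ℂ → ℂ} (hq : ContDiff ℝ (⊤ : ℕ∞) q) {b : (ℝ × ℂ) × ℂ → E}
    (hb : ContDiff ℝ (⊤ : ℕ∞) b) (x) :
    Dp (fun x => q x • b x) x = q x • Dp b x + Tq q b x := by
  have h1 := ((hq.differentiable (by simp)) x).hasFDerivAt.fun_smul
    ((hb.differentiable (by simp)) x).hasFDerivAt
  unfold Dp Tq
  rw [h1.fderiv]
  ext v <;> simp [Dp]

lemma Tq_contDiff {q : (ℝ × ℂ) × ℂ → ℂ} (hq : ContDiff ℝ (⊤ : ℕ∞) q) {b : (ℝ × ℂ) × ℂ → E}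
    (hb : ContDiff ℝ (⊤ : ℕ∞) b) : ContDiff ℝ (⊤ : ℕ∞) (Tq q b) := by
  have : Tq q b = fun x => Dp (fun x => q x • b x) x - q x • Dp b x := by
    funext x; rw [Dp_smul hq hb]; simp
  rw [this]
  exact (Dp_contDiff (hq.smul hb)).sub (hq.smul (Dp_contDiff hb))

lemma Dp_pow {q : (ℝ × ℂ) × ℂ → ℂ} (hq : ContDiff ℝ (⊤ : ℕ∞) q) {b : (ℝ × ℂ) × ℂ → E}
    (hb : ContDiff ℝ (⊤ : ℕ∞) b) (N m : ℕ) (x) :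
    Dp (fun x => ((N.descFactorial m : ℂ) * q x ^ (N - m)) • b x) x =
      ((N.descFactorial m : ℂ) * q x ^ (N - m)) • Dp b x +
      ((N.descFactorial (m + 1) : ℂ) * q x ^ (N - (m + 1))) • Tq q b x := by
  have hc : ContDiff ℝ (⊤ : ℕ∞) (fun x => (N.descFactorial m : ℂ) * q x ^ (N - m)) := by fun_prop
  rw [Dp_smul hc hb]
  congr 1
  have h1 := (((hq.differentiable (by simp)) x).hasFDerivAt.pow (N - m)).const_mul
    (N.descFactorial m : ℂ)
  unfold Tq Dp
  rw [h1.fderiv]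
  ext v <;> simp [Nat.descFactorial_succ, smul_smul, Nat.sub_sub] <;> ring_nf

end

lemma desc_tendsto (θ : ℝ) (h0 : 0 < θ) (h1 : θ < 1) (m : ℕ) :
    Tendsto (fun N : ℕ => (N.descFactorial m : ℝ) * θ ^ (N - m)) atTop (𝓝 0) := by
  have h := (tendsto_pow_const_mul_const_pow_of_abs_lt_one m
    (by rwa [abs_of_pos h0] : |θ| < 1)).const_mul ((θ ^ m)⁻¹)
  rw [mul_zero] at h
  refine squeeze_zero' (Eventually.of_forall fun N => by positivity) ?_ h
  filter_upwards [eventually_ge_atTop m] with N hN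
  have : θ ^ N = θ ^ (N - m) * θ ^ m := by rw [← pow_add, Nat.sub_add_cancel hN]
  rw [this]
  have h2 : (N.descFactorial m : ℝ) ≤ (N:ℝ) ^ m := by exact_mod_cast Nat.descFactorial_le_pow N m
  have h3 : (θ ^ m)⁻¹ * ((N:ℝ) ^ m * (θ ^ (N - m) * θ ^ m)) = (N:ℝ)^m * θ ^ (N - m) := by
    field_simp
  rw [h3]
  gcongr

lemma decay (q : (ℝ × ℂ) × ℂ → ℂ) (hq : ContDiff ℝ (⊤ : ℕ∞) q) (θ : ℝ) (hθ0 : 0 < θ)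
    (hθ1 : θ < 1) (hqθ : ∀ x, ‖q x‖ ≤ θ) (k : Set ℂ) (hk : IsCompact k) (K : Set (ℝ × ℂ))
    (hK : IsCompact K) (n : ℕ) : ∀ {E : Type} [NormedAddCommGroup E] [NormedSpace ℝ E]
    [NormedSpace ℂ E] [IsScalarTower ℝ ℂ E] [SMulCommClass ℝ ℂ E] (m : ℕ)
    (b : (ℝ × ℂ) × ℂ → E) (_ : ContDiff ℝ (⊤ : ℕ∞) b) (_ : ∀ p η, η ∉ k → b (p, η) = 0)
    (ε : ℝ) (_ : 0 < ε), ∀ᶠ N : ℕ in atTop, ∀ p ∈ K,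
      ‖iteratedFDeriv ℝ n (fun p => ∫ η, ((N.descFactorial m : ℂ) * q (p, η) ^ (N - m)) • b (p, η)) p‖
        ≤ ε := by
  induction n with
  | zero =>
    intro E _ _ _ _ _ m b hb h0 ε hε
    obtain ⟨C, hC⟩ := (hK.prod hk).exists_bound_of_continuousOn hb.continuous.continuousOn
    have ht := ((desc_tendsto θ hθ0 hθ1 m).mul_const |C|).mul_const (volume.real k)
    rw [zero_mul, zero_mul] at ht
    filter_upwards [ht.eventually (gt_mem_nhds hε)] with N hN p hp
    rw [norm_iteratedFDeriv_zero]
    have hset : ∫ η, ((N.descFactorial m : ℂ) * q (p, η) ^ (N - m)) • b (p, η)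
        = ∫ η in k, ((N.descFactorial m : ℂ) * q (p, η) ^ (N - m)) • b (p, η) := by
      refine (setIntegral_eq_integral_of_forall_compl_eq_zero fun η hη => ?_).symm
      rw [h0 p η hη, smul_zero]
    rw [hset]
    refine le_trans (norm_setIntegral_le_of_norm_le_const hk.measure_lt_top ?_) hN.le
    intro η hη
    rw [norm_smul, norm_mul, norm_pow, Complex.norm_natCast]
    have h1 : ‖b (p, η)‖ ≤ |C| := (hC (p, η) ⟨hp, hη⟩).trans (le_abs_self C)
    have := hqθ (p, η)
    gcongr
  | succ n ih =>
    intro E _ _ _ _ _ m b hb h0 ε hε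
    have hT := Tq_contDiff hq hb
    have hT0 : ∀ p η, η ∉ k → Tq q b (p, η) = 0 := by
      intro p η hη
      unfold Tq; rw [h0 p η hη]; ext v <;> simp
    filter_upwards [ih m (Dp b) (Dp_contDiff hb) (Dp_zero hb h0) (ε / 2) (by positivity),
      ih (m + 1) (Tq q b) hT hT0 (ε / 2) (by positivity)] with N h1 h2 p hp
    have hc : ∀ m, ContDiff ℝ (⊤ : ℕ∞) (fun x => (N.descFactorial m : ℂ) * q x ^ (N - m)) := by
      intro m; fun_prop
    have hF : ContDiff ℝ (⊤ : ℕ∞) (fun x => ((N.descFactorial m : ℂ) * q x ^ (N - m)) • b x) :=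
      (hc m).smul hb
    have hF1 : ContDiff ℝ (⊤ : ℕ∞) (fun x => ((N.descFactorial m : ℂ) * q x ^ (N - m)) • Dp b x) :=
      (hc m).smul (Dp_contDiff hb)
    have hF2 : ContDiff ℝ (⊤ : ℕ∞)
        (fun x => ((N.descFactorial (m + 1) : ℂ) * q x ^ (N - (m + 1))) • Tq q b x) :=
      (hc (m + 1)).smul hT
    have z : ∀ p η, η ∉ k → ((N.descFactorial m : ℂ) * q (p, η) ^ (N - m)) • b (p, η) = 0 :=
      fun p η hη => by rw [h0 p η hη, smul_zero]
    have z1 : ∀ p η, η ∉ k → ((N.descFactorial m : ℂ) * q (p, η) ^ (N - m)) • Dp b (p, η) = 0 :=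
      fun p η hη => by rw [Dp_zero hb h0 p η hη, smul_zero]
    have z2 : ∀ p η, η ∉ k →
        ((N.descFactorial (m+1) : ℂ) * q (p, η) ^ (N - (m+1))) • Tq q b (p, η) = 0 :=
      fun p η hη => by rw [hT0 p η hη, smul_zero]
    rw [← norm_iteratedFDeriv_fderiv]
    have hfd : fderiv ℝ (fun p => ∫ η, ((N.descFactorial m : ℂ) * q (p, η) ^ (N - m)) • b (p, η))
        = (fun p => ∫ η, ((N.descFactorial m : ℂ) * q (p, η) ^ (N - m)) • Dp b (p, η)) +
          (fun p => ∫ η, ((N.descFactorial (m+1) : ℂ) * q (p, η) ^ (N - (m+1))) • Tq q b (p, η)) := by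
      funext p
      rw [(int_hasFDerivAt hF hk z p).fderiv, Pi.add_apply, ← integral_add
        (slice_integrable hF1.continuous hk z1 p) (slice_integrable hF2.continuous hk z2 p)]
      congr 1; funext η
      exact Dp_pow hq hb N m (p, η)
    rw [hfd, iteratedFDeriv_add_apply (int_contDiff_nat n hF1 hk z1).contDiffAt
      (int_contDiff_nat n hF2 hk z2).contDiffAt]
    exact (norm_add_le _ _).trans (by linarith [h1 p hp, h2 p hp])


lemma piece (j : ℕ) (hj : 1 ≤ j) (G : ℝ × ℂ → ℂ) (hG : ContDiff ℝ (⊤ : ℕ∞) G)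
    (hin : ∀ w t, ‖t‖ < (j:ℝ) → G (w, t) = 0) (hout : ∀ w t, (j:ℝ) + 2 ≤ ‖t‖ → G (w, t) = 0) :
    ∃ u : ℝ × ℂ → ℂ, ContDiff ℝ (⊤ : ℕ∞) u ∧
      (∀ p, fderiv ℝ u p (0, 1) + I * fderiv ℝ u p (0, I) = G p) ∧
      ∀ m ≤ j, ∀ p ∈ Metric.ball (0 : ℝ × ℂ) ((j:ℝ) / 2), ‖iteratedFDeriv ℝ m u p‖ ≤ (1 / 2) ^ j := by
  have hj0 : (0:ℝ) < j := by exact_mod_cast hj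
  let ρ : ContDiffBump (0:ℂ) := ⟨(j:ℝ) / 2, 3 * j / 4, by positivity, by linarith⟩
  let ρ' : ContDiffBump (0:ℂ) := ⟨7 * (j:ℝ) / 8, j, by positivity, by linarith⟩
  set σ : ℂ → ℂ := fun z => (ρ z : ℂ) * z with hσ
  set τ : ℂ → ℂ := fun z => ((1 - ρ' z : ℝ) : ℂ) * z⁻¹ with hτ
  have hofReal : ContDiff ℝ (⊤ : ℕ∞) (fun r : ℝ => (r : ℂ)) := Complex.ofRealCLM.contDiff
  have hσs : ContDiff ℝ (⊤ : ℕ∞) σ := (hofReal.comp ρ.contDiff).mul contDiff_id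
  have hσid : ∀ z, ‖z‖ < (j:ℝ) / 2 → σ z = z := by
    intro z hz
    have : ρ z = 1 := ρ.one_of_mem_closedBall (by simpa using hz.le)
    simp [hσ, this]
  have hσb : ∀ z, ‖σ z‖ ≤ 3 * j / 4 := by
    intro z
    by_cases hz : ‖z‖ ≤ 3 * j / 4
    · simp only [hσ, norm_mul, norm_real, Real.norm_eq_abs, abs_of_nonneg ρ.nonneg]
      calc ρ z * ‖z‖ ≤ 1 * ‖z‖ := by gcongr; exact ρ.le_one
        _ ≤ _ := by linarith
    · have : ρ z = 0 := ρ.zero_of_le_dist (by simpa using (not_le.1 hz).le)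
      simp only [hσ, this, ofReal_zero, zero_mul, norm_zero]
      positivity
  have hτs : ContDiff ℝ (⊤ : ℕ∞) τ := by
    rw [contDiff_iff_contDiffAt]
    intro z
    by_cases hz : z = 0
    · have : τ =ᶠ[𝓝 z] fun _ => 0 := by
        have hb : Metric.ball (0:ℂ) (7 * (j:ℝ) / 8) ∈ 𝓝 z := by
          rw [hz]; exact Metric.ball_mem_nhds _ (by positivity)
        filter_upwards [hb] with y hy
        have : ρ' y = 1 := ρ'.one_of_mem_closedBall (Metric.ball_subset_closedBall hy)
        simp [hτ, this]
      exact contDiffAt_const.congr_of_eventuallyEq this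
    · exact ((hofReal.comp (contDiff_const.sub ρ'.contDiff)).contDiffAt).mul
        ((contDiffAt_inv ℂ hz).restrict_scalars ℝ)
  have hτv : ∀ z, (j:ℝ) ≤ ‖z‖ → τ z = z⁻¹ := by
    intro z hz
    have : ρ' z = 0 := ρ'.zero_of_le_dist (by simpa using hz)
    simp [hτ, this]
  have hτb : ∀ z, ‖τ z‖ ≤ 8 / (7 * j) := by
    intro z
    by_cases hz : ‖z‖ ≤ 7 * (j:ℝ) / 8
    · have : ρ' z = 1 := ρ'.one_of_mem_closedBall (by simpa using hz)
      simp [hτ, this]; positivity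
    · have hz' := not_le.1 hz
      simp only [hτ, norm_mul, norm_real, Real.norm_eq_abs, norm_inv,
        abs_of_nonneg (sub_nonneg.2 (ρ'.le_one (x := z)))]
      calc (1 - ρ' z) * ‖z‖⁻¹ ≤ 1 * (7 * (j:ℝ) / 8)⁻¹ := by
            gcongr
            linarith [ρ'.nonneg (x := z)]
        _ = _ := by rw [one_mul, inv_div]
  set q : (ℝ × ℂ) × ℂ → ℂ := fun x => σ x.1.2 * τ x.2 with hq
  have hqs : ContDiff ℝ (⊤ : ℕ∞) q :=
    (hσs.comp (by fun_prop)).mul (hτs.comp (by fun_prop))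
  have hqb : ∀ x, ‖q x‖ ≤ 6 / 7 := by
    intro x
    rw [hq, norm_mul]
    calc ‖σ x.1.2‖ * ‖τ x.2‖ ≤ (3 * j / 4) * (8 / (7 * j)) := by
          gcongr
          · exact hσb _
          · exact hτb _
      _ = 6 / 7 := by field_simp; norm_num
  set b : (ℝ × ℂ) × ℂ → ℂ := fun x => dK (σ x.1.2 - x.2) * G (x.1.1, x.2) with hb
  have hbs : ContDiff ℝ (⊤ : ℕ∞) b := by
    rw [contDiff_iff_contDiffAt]
    rintro x
    by_cases hx : ‖x.2‖ < j
    · have : b =ᶠ[𝓝 x] fun _ => 0 := by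
        filter_upwards [(isOpen_lt (by fun_prop : Continuous fun x : (ℝ × ℂ) × ℂ => ‖x.2‖)
          (continuous_const (y := (j:ℝ)))).mem_nhds hx] with y hy
        simp only [hb, hin _ _ hy, mul_zero]
      exact contDiffAt_const.congr_of_eventuallyEq this
    · have hne : σ x.1.2 - x.2 ≠ 0 := by
        intro h
        have := hσb x.1.2
        rw [sub_eq_zero.1 h] at this
        linarith [not_lt.1 hx]
      have h1 : ContDiffAt ℝ (⊤ : ℕ∞) dK (σ x.1.2 - x.2) := by
        have h2 : (2 * (Real.pi : ℂ) * (σ x.1.2 - x.2)) ≠ 0 := by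
          have : (Real.pi : ℂ) ≠ 0 := by exact_mod_cast Real.pi_ne_zero
          exact mul_ne_zero (mul_ne_zero two_ne_zero this) hne
        unfold dK
        exact ContDiffAt.inv (by fun_prop) h2
      have h3 : ContDiff ℝ (⊤ : ℕ∞) (fun x : (ℝ × ℂ) × ℂ => σ x.1.2 - x.2) :=
        (hσs.comp (by fun_prop)).sub (by fun_prop)
      have h4 : ContDiff ℝ (⊤ : ℕ∞) (fun x : (ℝ × ℂ) × ℂ => G (x.1.1, x.2)) :=
        hG.comp (by fun_prop)
      exact (ContDiffAt.comp (g := dK) x h1 h3.contDiffAt).mul h4.contDiffAt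
  have hb0 : ∀ p η, η ∉ Metric.closedBall (0:ℂ) (j + 2) → b (p, η) = 0 := by
    intro p η hη
    simp only [Metric.mem_closedBall, dist_zero_right, not_le] at hη
    simp only [hb, hout _ _ hη.le, mul_zero]
  have hdec : ∀ᶠ N : ℕ in atTop, ∀ m ∈ Finset.range (j + 1),
      ∀ p ∈ Metric.closedBall (0 : ℝ × ℂ) ((j:ℝ) / 2),
      ‖iteratedFDeriv ℝ m (fun p => ∫ η, ((N.descFactorial 0 : ℂ) * q (p, η) ^ (N - 0)) • b (p, η)) p‖
        ≤ (1 / 2) ^ j := by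
    rw [Filter.eventually_all_finset]
    intro m _
    exact decay q hqs (6/7) (by norm_num) (by norm_num) hqb _ (isCompact_closedBall 0 ((j:ℝ) + 2)) _
      (isCompact_closedBall _ _) m 0 b hbs hb0 _ (by positivity)
  obtain ⟨N, hN⟩ := hdec.exists
  set GN : ℝ × ℂ → ℂ := fun p => G p * τ p.2 ^ N with hGN
  have hGNs : ContDiff ℝ (⊤ : ℕ∞) GN := hG.mul ((hτs.comp (by fun_prop)).pow N)
  obtain ⟨hv, hvd⟩ := cauchy_param GN hGNs (j + 2) (fun w t ht => by simp [hGN, hout w t ht])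
  set v := (fun p : ℝ × ℂ => ∫ t, dK (p.2 - t) * GN (p.1, t)) with hvdef
  refine ⟨fun p => p.2 ^ N * v p, (contDiff_snd.pow N).mul hv, ?_, ?_⟩
  · rintro ⟨w, ζ⟩
    have hpow : HasFDerivAt (fun p : ℝ × ℂ => p.2 ^ N) (_ : ℝ × ℂ →L[ℝ] ℂ) (w, ζ) :=
      (hasFDerivAt_snd (𝕜 := ℝ) (p := (w, ζ))).pow N
    have h1 := hpow.mul ((hv.differentiable (by simp)) (w, ζ)).hasFDerivAt
    have h2 : fderiv ℝ (fun p : ℝ × ℂ => p.2 ^ N * v p) (w, ζ) = _ := h1.fderiv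
    rw [h2]
    have h3 := hvd (w, ζ)
    have h4 : ζ ^ N * GN (w, ζ) = G (w, ζ) := by
      by_cases hz : ‖ζ‖ < j
      · simp [hGN, hin w ζ hz]
      · have hz' := not_lt.1 hz
        have : ζ ≠ 0 := by
          rintro rfl; simp at hz'; omega
        simp only [hGN]
        rw [hτv ζ hz', inv_pow]
        field_simp
    rw [← h4, ← h3]
    simp
    linear_combination ((N:ℂ) * ζ ^ (N - 1) * v (w, ζ)) * I_sq
  · intro m hm p hp
    have heq : (fun p : ℝ × ℂ => p.2 ^ N * v p) =ᶠ[𝓝 p]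
        (fun p => ∫ η, ((N.descFactorial 0 : ℂ) * q (p, η) ^ (N - 0)) • b (p, η)) := by
      filter_upwards [Metric.isOpen_ball.mem_nhds hp] with y hy
      have hy2 : ‖y.2‖ < (j:ℝ)/2 := lt_of_le_of_lt (norm_snd_le y) (by simpa using hy)
      simp only [hvdef, ← integral_const_mul]
      congr 1; funext η
      simp only [hq, hb, hσid _ hy2, hGN, Nat.descFactorial_zero, Nat.sub_zero, smul_eq_mul]
      push_cast; ring
    rw [heq.iteratedFDeriv ℝ m |>.eq_of_nhds]
    exact hN m (Finset.mem_range.2 (by omega)) p (Metric.ball_subset_closedBall hp)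

lemma series (u : ℕ → ℝ × ℂ → ℂ) (hu : ∀ j, ContDiff ℝ (⊤ : ℕ∞) (u j))
    (hb : ∀ j : ℕ, ∀ m ≤ j, ∀ p ∈ Metric.ball (0 : ℝ × ℂ) ((j:ℝ) / 2),
      ‖iteratedFDeriv ℝ m (u j) p‖ ≤ (1 / 2) ^ j) :
    ContDiff ℝ (⊤ : ℕ∞) (fun p => ∑' j, u j p) ∧
    ∀ p, Summable (fun j => fderiv ℝ (u j) p) ∧
      fderiv ℝ (fun p => ∑' j, u j p) p = ∑' j, fderiv ℝ (u j) p := by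
  have hgeo : Summable (fun j : ℕ => (1/2 : ℝ) ^ j) := summable_geometric_two
  constructor
  · rw [contDiff_iff_contDiffAt]
    intro p
    let χ : ContDiffBump (0 : ℝ × ℂ) := ⟨‖p‖ + 1, ‖p‖ + 2, by positivity, by linarith⟩
    have hM : ∀ i : ℕ, ∃ C, ∀ x, ‖iteratedFDeriv ℝ i χ x‖ ≤ C := by
      intro i
      have h1 : ContDiff ℝ (⊤ : ℕ∞) χ := χ.contDiff
      exact (χ.hasCompactSupport.iteratedFDeriv (𝕜 := ℝ) i).exists_bound_of_continuous
        (h1.continuous_iteratedFDeriv (by exact_mod_cast le_top))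
    choose M hM using hM
    have hM0 : ∀ i, 0 ≤ M i := fun i => (norm_nonneg _).trans (hM i 0)
    have hS : ContDiff ℝ (⊤ : ℕ∞) (fun x => ∑' j, χ x • u j x) := by
      refine contDiff_tsum_of_eventually (N := ⊤) (v := fun k j =>
        (∑ i ∈ Finset.range (k + 1), (k.choose i : ℝ) * M i) * (1/2) ^ j)
        (fun j => χ.contDiff.smul (hu j)) (fun k _ => hgeo.mul_left _) ?_
      intro k _
      rw [Nat.cofinite_eq_atTop]
      obtain ⟨J, hJ⟩ := exists_nat_gt (2 * (‖p‖ + 2))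
      filter_upwards [eventually_ge_atTop k, eventually_ge_atTop J] with j hjk hjJ x
      have hjJ' : (J:ℝ) ≤ j := by exact_mod_cast hjJ
      have h1 := norm_iteratedFDeriv_smul_le (𝕜 := ℝ) (f := χ) (g := u j) (N := (⊤ : ℕ∞))
        χ.contDiff (hu j) x (n := k) (by exact_mod_cast le_top)
      refine h1.trans ?_
      rw [Finset.sum_mul]
      refine Finset.sum_le_sum fun i hi => ?_
      by_cases hx : x ∈ tsupport χ
      · rw [χ.tsupport_eq] at hx
        have hx' : ‖x‖ ≤ ‖p‖ + 2 := by simpa using hx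
        have h2 := hb j (k - i) (by omega) x (by simp; linarith)
        have h3 := hM i x
        have := hM0 i
        gcongr
      · have : iteratedFDeriv ℝ i χ x = 0 := by
          by_contra hne
          exact hx (support_iteratedFDeriv_subset (𝕜 := ℝ) i hne)
        rw [this]
        have := hM0 i
        simp only [norm_zero, mul_zero, zero_mul]
        positivity
    refine hS.contDiffAt.congr_of_eventuallyEq ?_
    have hp : p ∈ Metric.ball (0 : ℝ × ℂ) (‖p‖ + 1) := by simp
    filter_upwards [Metric.isOpen_ball.mem_nhds hp] with x hx
    have : χ x = 1 := χ.one_of_mem_closedBall (Metric.ball_subset_closedBall hx)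
    simp [this]
  · intro p
    obtain ⟨J, hJ⟩ := exists_nat_gt (2 * (‖p‖ + 1))
    have hC : ∀ j, ∃ C, (∀ x ∈ Metric.ball (0 : ℝ × ℂ) (‖p‖ + 1), ‖fderiv ℝ (u j) x‖ ≤ C) ∧
        (J ≤ j → C = (1/2) ^ j) := by
      intro j
      by_cases hj : J ≤ j
      · refine ⟨(1/2)^j, fun x hx => ?_, fun _ => rfl⟩
        have hjJ' : (J:ℝ) ≤ j := by exact_mod_cast hj
        rw [← norm_iteratedFDeriv_one]
        refine hb j 1 ?_ x (Metric.ball_subset_ball (by linarith) hx)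
        by_contra hc
        have : j = 0 := by omega
        rw [this] at hjJ'
        push_cast at hjJ'
        linarith [norm_nonneg p]
      · obtain ⟨C, hC⟩ := (isCompact_closedBall (0 : ℝ × ℂ) (‖p‖ + 1)).exists_bound_of_continuousOn
          ((hu j).continuous_fderiv (by simp)).continuousOn
        exact ⟨C, fun x hx => hC x (Metric.ball_subset_closedBall hx), fun h => absurd h hj⟩
    choose C hC hC' using hC
    have hCs : Summable C := by
      refine hgeo.congr_atTop ?_
      filter_upwards [eventually_ge_atTop J] with j hj using (hC' j hj).symm
    have hp : p ∈ Metric.ball (0 : ℝ × ℂ) (‖p‖ + 1) := by simp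
    have hsum : Summable (fun j => u j p) := by
      refine Summable.of_norm_bounded_eventually_nat hgeo ?_
      filter_upwards [eventually_ge_atTop J] with j hj
      have hjJ' : (J:ℝ) ≤ j := by exact_mod_cast hj
      rw [← norm_iteratedFDeriv_zero (𝕜 := ℝ)]
      exact hb j 0 (by omega) p (by simp; linarith)
    refine ⟨Summable.of_norm_bounded hCs fun j => hC j p hp, ?_⟩
    exact (hasFDerivAt_tsum_of_isPreconnected hCs Metric.isOpen_ball
      (convex_ball _ _).isPreconnected
      (fun j x _ => ((hu j).differentiable (by simp) x).hasFDerivAt) hC hp hsum hp).fderiv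

lemma dbar_solvable (h : ℝ × ℂ → ℂ) (hh : ContDiff ℝ (⊤ : ℕ∞) h) :
    ∃ u : ℝ × ℂ → ℂ, ContDiff ℝ (⊤ : ℕ∞) u ∧
      ∀ p, fderiv ℝ u p (0, 1) + I * fderiv ℝ u p (0, I) = h p := by
  let ρ : ∀ j : ℕ, ContDiffBump (0:ℂ) := fun j => ⟨(j:ℝ) + 1, j + 2, by positivity, by linarith⟩
  have hofReal : ContDiff ℝ (⊤ : ℕ∞) (fun r : ℝ => (r : ℂ)) := Complex.ofRealCLM.contDiff
  have hρ1 : ∀ j : ℕ, ∀ z : ℂ, ‖z‖ ≤ j + 1 → ρ j z = 1 := fun j z hz =>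
    (ρ j).one_of_mem_closedBall (by simpa using hz)
  have hρ0 : ∀ j : ℕ, ∀ z : ℂ, (j:ℝ) + 2 ≤ ‖z‖ → ρ j z = 0 := fun j z hz =>
    (ρ j).zero_of_le_dist (by simpa using hz)
  let c : ℕ → ℂ → ℝ := fun j => Nat.casesOn j (fun z => ρ 0 z) (fun i z => ρ (i + 1) z - ρ i z)
  have hcs : ∀ j, ContDiff ℝ (⊤ : ℕ∞) (c j) := by
    intro j
    cases j with
    | zero => exact (ρ 0).contDiff
    | succ i => exact (ρ (i+1)).contDiff.sub (ρ i).contDiff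
  have hcin : ∀ j : ℕ, ∀ z : ℂ, ‖z‖ < j → c j z = 0 := by
    intro j z hz
    cases j with
    | zero => simp at hz; linarith [norm_nonneg z]
    | succ i =>
      push_cast at hz
      show ρ (i+1) z - ρ i z = 0
      rw [hρ1 i z hz.le, hρ1 (i+1) z (by push_cast; linarith), sub_self]
  have hcout : ∀ j : ℕ, ∀ z : ℂ, (j:ℝ) + 2 ≤ ‖z‖ → c j z = 0 := by
    intro j z hz
    cases j with
    | zero => exact hρ0 0 z hz
    | succ i =>
      show ρ (i+1) z - ρ i z = 0
      rw [hρ0 (i+1) z hz, hρ0 i z (by push_cast at hz; linarith), sub_self]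
  have hcsum : ∀ n : ℕ, ∀ z, ∑ j ∈ Finset.range (n + 1), c j z = ρ n z := by
    intro n z
    induction n with
    | zero => simp [c]
    | succ n ih =>
      rw [Finset.sum_range_succ, ih]
      show ρ n z + (ρ (n+1) z - ρ n z) = _
      ring
  set H : ℕ → ℝ × ℂ → ℂ := fun j p => Complex.ofReal (c j p.2) * h p with hH
  have hHs : ∀ j, ContDiff ℝ (⊤ : ℕ∞) (H j) := fun j =>
    (hofReal.comp ((hcs j).comp contDiff_snd)).mul hh
  have hHin : ∀ j : ℕ, ∀ w t, ‖t‖ < (j:ℝ) → H j (w, t) = 0 := fun j w t ht => by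
    simp [hH, hcin j t ht]
  have hHout : ∀ j : ℕ, ∀ w t, (j:ℝ) + 2 ≤ ‖t‖ → H j (w, t) = 0 := fun j w t ht => by
    simp [hH, hcout j t ht]
  have hex : ∀ j : ℕ, ∃ u : ℝ × ℂ → ℂ, ContDiff ℝ (⊤ : ℕ∞) u ∧
      (∀ p, fderiv ℝ u p (0, 1) + I * fderiv ℝ u p (0, I) = H j p) ∧
      ∀ m ≤ j, ∀ p ∈ Metric.ball (0 : ℝ × ℂ) ((j:ℝ) / 2),
        ‖iteratedFDeriv ℝ m u p‖ ≤ (1 / 2) ^ j := by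
    intro j
    rcases Nat.eq_zero_or_pos j with rfl | hj
    · obtain ⟨h1, h2⟩ := cauchy_param (H 0) (hHs 0) _ (hHout 0)
      exact ⟨_, h1, h2, fun m _ p hp => by simp at hp⟩
    · exact piece j hj (H j) (hHs j) (hHin j) (hHout j)
  choose u hus hud hub using hex
  obtain ⟨hs, hd⟩ := series u hus hub
  refine ⟨_, hs, fun p => ?_⟩
  obtain ⟨hsum, hfd⟩ := hd p
  have hev : ∀ v, HasSum (fun j => fderiv ℝ (u j) p v) (fderiv ℝ (fun p => ∑' j, u j p) p v) := by
    intro v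
    rw [hfd]
    exact hsum.hasSum.mapL (ContinuousLinearMap.apply ℝ ℂ v)
  have h1 := (hev (0, 1)).add ((hev (0, I)).mul_left I)
  simp only [hud] at h1
  refine h1.unique ?_
  obtain ⟨n, hn⟩ := exists_nat_gt ‖p.2‖
  have h2 : HasSum (fun j => H j p) (∑ j ∈ Finset.range (n + 1), H j p) := by
    refine hasSum_sum_of_ne_finset_zero fun j hj => hHin j p.1 p.2 ?_
    have : n < j := by simpa using hj
    have : (n:ℝ) < j := by exact_mod_cast this
    linarith
  convert h2 using 1
  simp only [hH]
  rw [← Finset.sum_mul, ← ofReal_sum, hcsum, hρ1 n p.2 (by linarith)]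
  simp

/-- The operator `y∂z + ∂x + i∂y + ix∂z` is solvable on smooth functions. -/
theorem opL_solvable (g : ℝ × ℝ × ℝ → ℂ) (hg : ContDiff ℝ (⊤ : ℕ∞) g) :
    ∃ f : ℝ × ℝ × ℝ → ℂ, ContDiff ℝ (⊤ : ℕ∞) f ∧ ∀ p : ℝ × ℝ × ℝ, OpL f p = g p := by
  have hre : ContDiff ℝ (⊤ : ℕ∞) (fun z : ℂ => z.re) := Complex.reCLM.contDiff
  have him : ContDiff ℝ (⊤ : ℕ∞) (fun z : ℂ => z.im) := Complex.imCLM.contDiff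
  have hofReal : ContDiff ℝ (⊤ : ℕ∞) (fun r : ℝ => (r : ℂ)) := Complex.ofRealCLM.contDiff
  obtain ⟨u, hu, hd⟩ := dbar_solvable (fun p => g (p.1 + p.2.re * p.2.im, p.2.im, p.2.re))
    (hg.comp ((contDiff_fst.add ((hre.comp contDiff_snd).mul (him.comp contDiff_snd))).prodMk
      ((him.comp contDiff_snd).prodMk (hre.comp contDiff_snd))))
  refine ⟨fun p => u (p.1 - p.2.2 * p.2.1, (p.2.2 : ℂ) + p.2.1 * I), ?_, ?_⟩
  · refine hu.comp (ContDiff.prodMk (by fun_prop) (ContDiff.add ?_ (ContDiff.mul ?_ contDiff_const)))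
    · exact hofReal.comp (contDiff_snd.comp contDiff_snd)
    · exact hofReal.comp (contDiff_fst.comp contDiff_snd)
  · rintro ⟨z, y, x⟩
    have hD := ((hu.differentiable (by simp)) (z - x * y, (x : ℂ) + y * I)).hasFDerivAt
    have hcast : ∀ t : ℝ, HasDerivAt (fun r : ℝ => (r : ℂ)) 1 t := fun t => by
      exact (Complex.ofRealCLM.hasDerivAt (x := t)).congr_deriv (by simp)
    have hz : HasDerivAt (fun t : ℝ => ((t - x * y, (x : ℂ) + y * I) : ℝ × ℂ)) (1, 0) z :=
      ((hasDerivAt_id z).sub_const _).prodMk (hasDerivAt_const _ _)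
    have hy : HasDerivAt (fun t : ℝ => ((z - x * t, (x : ℂ) + t * I) : ℝ × ℂ)) (-x, I) y := by
      refine HasDerivAt.prodMk ?_ ?_
      · simpa using ((hasDerivAt_id y).const_mul x).const_sub z
      · simpa using ((hcast y).mul_const I).const_add (x : ℂ)
    have hx : HasDerivAt (fun t : ℝ => ((z - t * y, (t : ℂ) + y * I) : ℝ × ℂ)) (-y, 1) x := by
      refine HasDerivAt.prodMk ?_ ?_
      · simpa using ((hasDerivAt_id x).mul_const y).const_sub z
      · simpa using (hcast x).add_const ((y : ℂ) * I)
    have ez := (hD.comp_hasDerivAt z hz).deriv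
    have ey := (hD.comp_hasDerivAt y hy).deriv
    have ex := (hD.comp_hasDerivAt x hx).deriv
    simp only [Function.comp_def] at ez ey ex
    simp only [OpL, Pz, Py, Px]
    rw [ez, ey, ex]
    have key := hd (z - x * y, (x : ℂ) + y * I)
    simp only [add_re, add_im, ofReal_re, ofReal_im, mul_re, mul_im, I_re, I_im, mul_zero, mul_one,
      sub_zero, add_zero, zero_add, sub_self, sub_add_cancel, zero_mul] at key
    rw [← key]
    set D := fderiv ℝ u (z - x * y, (x : ℂ) + y * I)
    have h1 : ∀ (a : ℝ) (v : ℂ), D (-a, v) = D (0, v) - a * D (1, 0) := by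
      intro a v
      rw [show ((-a, v) : ℝ × ℂ) = (0, v) - a • (1, 0) by simp, map_sub, map_smul, real_smul]
    rw [h1, h1]
    ring
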